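/- (Tempo–Bai–Dabbene, Theorem 3.1, as used in the proof of Proposition 1.) Let (Ω, 𝒜, μ) be a probability space, let Q : Ω → ℝ be a measurable function, let ε ∈ (0,1) and β ∈ (0,1), and let N ≥ 1 be a natural number with N ≥ ln(1/β) / ln(1/(1−ε)). For s ∈ Ω^N let Q̂_N(s) = max_{i=1,…,N} Q(s_i) denote the empirical maximum over the N samples. Then the product measure μ^⊗N of the set { s ∈ Ω^N : μ{ ω ∈ Ω : Q(ω) > Q̂_N(s) } > ε } is at most β. That is, with confidence at least 1 − β over the draw of N i.i.d. samples, the probability that Q exceeds the empirical maximum of the samples is at most ε. -/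

import Mathlib

open MeasureTheory

/-- The values whose strict upper tail is heavier than `ε` carry mass at most `1 - ε`. -/
theorem measure_lt_tail_le {Ω : Type*} [MeasurableSpace Ω] (μ : Measure Ω)
    [IsProbabilityMeasure μ] {Q : Ω → ℝ} (hQ : Measurable Q) (ε : ENNReal) :
    μ {x | ε < μ {ω | Q x < Q ω}} ≤ 1 - ε := by
  let T : Set ℝ := {t | ε < μ {ω | t < Q ω}}
  have hlower : ∀ {a b : ℝ}, a ≤ b → b ∈ T → a ∈ T := fun hab hb =>
    lt_of_lt_of_le hb (measure_mono fun ω hω => lt_of_le_of_lt hab hω)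
  have hIic : ∀ t ∈ T, μ (Q ⁻¹' Set.Iic t) ≤ 1 - ε := by
    intro t ht
    have hcompl : Q ⁻¹' Set.Iic t = {ω | t < Q ω}ᶜ := by
      ext ω
      simp
    rw [hcompl, prob_compl_eq_one_sub (measurableSet_lt measurable_const hQ)]
    exact tsub_le_tsub_left (le_of_lt ht) 1
  change μ (Q ⁻¹' T) ≤ 1 - ε
  by_cases hmax : ∃ t, IsGreatest T t
  · obtain ⟨t, ht, hub⟩ := hmax
    exact (measure_mono (Set.preimage_mono fun _ hx => hub hx)).trans (hIic t ht)
  · have hcover : Q ⁻¹' T ⊆ ⋃ q ∈ {q : ℚ | (q : ℝ) ∈ T}, Q ⁻¹' Set.Iic (q : ℝ) := by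
      intro ω hω
      obtain ⟨y, hy, hlt⟩ : ∃ y ∈ T, Q ω < y := by
        by_contra! h
        exact hmax ⟨Q ω, hω, h⟩
      obtain ⟨q, hq₁, hq₂⟩ := exists_rat_btwn hlt
      exact Set.mem_biUnion (show (q : ℝ) ∈ T from hlower hq₂.le hy) hq₁.le
    refine (measure_mono hcover).trans ?_
    rw [measure_biUnion_eq_iSup (Set.to_countable _)]
    · exact iSup₂_le fun q hq => hIic q hq
    · intro p hp q hq
      rcases le_total p q with h | h
      · exact ⟨q, hq, Set.preimage_mono (Set.Iic_subset_Iic.2 (by exact_mod_cast h)),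
          subset_rfl⟩
      · exact ⟨p, hp, subset_rfl,
          Set.preimage_mono (Set.Iic_subset_Iic.2 (by exact_mod_cast h))⟩

theorem one_sub_pow_le_of_log_div_log_le {ε β : ℝ} (hε : ε ∈ Set.Ioo (0 : ℝ) 1) (hβ : 0 < β)
    {N : ℕ} (hN : Real.log (1 / β) / Real.log (1 / (1 - ε)) ≤ (N : ℝ)) :
    (1 - ε) ^ N ≤ β := by
  have h₀ : 0 < 1 - ε := sub_pos.2 hε.2
  have hlog : Real.log (1 - ε) < 0 := Real.log_neg h₀ (by linarith [hε.1])
  rw [one_div, one_div, Real.log_inv, Real.log_inv, div_le_iff₀ (by linarith)] at hN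
  rw [← Real.log_le_log_iff (pow_pos h₀ N) hβ, Real.log_pow]
  linarith

/-- Tempo–Bai–Dabbene, Theorem 3.1: with `N ≥ max(1, ln(1/β)/ln(1/(1−ε)))` i.i.d.
samples, the probability (over the samples) that the set where `Q` strictly exceeds
the empirical maximum `Q̂_N(s) = max_i Q(s_i)` has `μ`-measure greater than `ε`
is at most `β`. -/
theorem tempo_bai_dabbene {Ω : Type*} [MeasurableSpace Ω]
    (μ : Measure Ω) [IsProbabilityMeasure μ]
    (Qf : Ω → ℝ) (hQf : Measurable Qf)
    (ε β : ℝ) (hε : ε ∈ Set.Ioo (0 : ℝ) 1) (hβ : β ∈ Set.Ioo (0 : ℝ) 1)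
    (N : ℕ) (hN1 : 1 ≤ N)
    (hN : Real.log (1 / β) / Real.log (1 / (1 - ε)) ≤ (N : ℝ)) :
    Measure.pi (fun _ : Fin N => μ)
      {s : Fin N → Ω | ENNReal.ofReal ε < μ {ω : Ω | (⨆ i : Fin N, Qf (s i)) < Qf ω}}
      ≤ ENNReal.ofReal β := by
  have hsub : {s : Fin N → Ω |
      ENNReal.ofReal ε < μ {ω : Ω | (⨆ i : Fin N, Qf (s i)) < Qf ω}} ⊆
      Set.univ.pi fun _ => {x | ENNReal.ofReal ε < μ {ω | Qf x < Qf ω}} := fun s hs i _ =>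
    lt_of_lt_of_le hs (measure_mono fun ω hω =>
      lt_of_le_of_lt (le_ciSup (f := fun i => Qf (s i)) (Set.finite_range _).bddAbove i) hω)
  refine (measure_mono hsub).trans ?_
  rw [Measure.pi_pi, Finset.prod_const, Finset.card_univ, Fintype.card_fin]
  calc _ ≤ (1 - ENNReal.ofReal ε) ^ N := by
        gcongr
        exact measure_lt_tail_le μ hQf _
    _ = ENNReal.ofReal ((1 - ε) ^ N) := by
        rw [ENNReal.ofReal_pow (sub_nonneg.2 hε.2.le), ENNReal.ofReal_sub _ hε.1.le,
          ENNReal.ofReal_one]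
    _ ≤ ENNReal.ofReal β :=
        ENNReal.ofReal_le_ofReal (one_sub_pow_le_of_log_div_log_le hε hβ.1 hN)
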